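/- arXiv:2209.13788 — 2 statements merged into one kernel-verified Lean document; each statement's English description precedes it below -/
import Mathlib

section
/- Under Assumptions 1 and 2, the set-valued maps Φ and Ψ are outer semicontinuous; equivalently, the graphs gph Φ = {(u, v) : v ∈ Φ(u)} and gph Ψ = {(v, u) : u ∈ Ψ(v)} are closed subsets of ℝ^r × ℝ^r. -/
open Matrix Set Topology Filter

noncomputable section

variable {q m r : ℕ}

/-- The dual cone `K* = {y : ⟨y,x⟩ ≥ 0 for all x ∈ K}`. -/
def dualCone (K : Set (Fin q → ℝ)) : Set (Fin q → ℝ) :=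
  {y | ∀ x ∈ K, 0 ≤ y ⬝ᵥ x}

/-- `K` is a pointed, closed, convex cone with nonempty interior. -/
def ConeAssumptions (K : Set (Fin q → ℝ)) : Prop :=
  IsClosed K ∧ Convex ℝ K ∧ (∀ x ∈ K, ∀ t : ℝ, 0 < t → t • x ∈ K) ∧
    (∀ x ∈ K, x ≠ 0 → -x ∉ K) ∧ (interior K).Nonempty

/-- The mpKKT system for parameters `(u,v)` with data `(x,w,y)`. -/
def mpKKT (K : Set (Fin q → ℝ)) (A : Matrix (Fin m) (Fin q) ℝ)
    (M : Matrix (Fin r) (Fin q) ℝ) (b : Fin m → ℝ) (c d : Fin q → ℝ)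
    (u v : Fin r → ℝ) (x : Fin q → ℝ) (w : Fin m → ℝ) (y : Fin q → ℝ) : Prop :=
  A.mulVec x = b ∧ M.mulVec x = M.mulVec d + v ∧ x ∈ K ∧
    Aᵀ.mulVec w + y = c + Mᵀ.mulVec u ∧ y ∈ dualCone K ∧ x ⬝ᵥ y = 0

/-- The set-valued map `Φ`. -/
def Phi (K : Set (Fin q → ℝ)) (A : Matrix (Fin m) (Fin q) ℝ)
    (M : Matrix (Fin r) (Fin q) ℝ) (b : Fin m → ℝ) (c d : Fin q → ℝ)
    (u : Fin r → ℝ) : Set (Fin r → ℝ) :=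
  {v | ∃ x w y, mpKKT K A M b c d u v x w y}

/-- The set-valued map `Ψ`. -/
def Psi (K : Set (Fin q → ℝ)) (A : Matrix (Fin m) (Fin q) ℝ)
    (M : Matrix (Fin r) (Fin q) ℝ) (b : Fin m → ℝ) (c d : Fin q → ℝ)
    (v : Fin r → ℝ) : Set (Fin r → ℝ) :=
  {u | ∃ x w y, mpKKT K A M b c d u v x w y}

/-- The primal conic representable set `ΘP`. -/
def ThetaP (K : Set (Fin q → ℝ)) (A : Matrix (Fin m) (Fin q) ℝ)
    (M : Matrix (Fin r) (Fin q) ℝ) (b : Fin m → ℝ) (d : Fin q → ℝ) :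
    Set (Fin r → ℝ) :=
  {v | ∃ x ∈ K, A.mulVec x = b ∧ M.mulVec x = M.mulVec d + v}

/-- The dual conic representable set `ΘD`. -/
def ThetaD (K : Set (Fin q → ℝ)) (A : Matrix (Fin m) (Fin q) ℝ)
    (M : Matrix (Fin r) (Fin q) ℝ) (c : Fin q → ℝ) : Set (Fin r → ℝ) :=
  {u | ∃ w : Fin m → ℝ, ∃ y ∈ dualCone K, Aᵀ.mulVec w + y = c + Mᵀ.mulVec u}

/-- Assumption 1: full row rank and trivially intersecting row spaces. -/
def Assumption1 (A : Matrix (Fin m) (Fin q) ℝ) (M : Matrix (Fin r) (Fin q) ℝ) : Prop :=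
  LinearIndependent ℝ A ∧ LinearIndependent ℝ M ∧
    Submodule.span ℝ (Set.range A) ⊓ Submodule.span ℝ (Set.range M) = ⊥

/-- Assumption 2 (Slater condition). -/
def Assumption2 (K : Set (Fin q → ℝ)) (A : Matrix (Fin m) (Fin q) ℝ)
    (M : Matrix (Fin r) (Fin q) ℝ) (b : Fin m → ℝ) (c : Fin q → ℝ) : Prop :=
  (∃ x ∈ interior K, A.mulVec x = b) ∧
    ∃ (w : Fin m → ℝ) (s : Fin r → ℝ),
      c - Aᵀ.mulVec w - Mᵀ.mulVec s ∈ interior (dualCone K)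

/-- A basic semialgebraic set: finitely many polynomial equalities and strict inequalities. -/
def IsBasicSemialgebraic {ι : Type} [Fintype ι] (S : Set (ι → ℝ)) : Prop :=
  ∃ (k l : ℕ) (f : Fin k → MvPolynomial ι ℝ) (g : Fin l → MvPolynomial ι ℝ),
    S = {x | (∀ i, MvPolynomial.eval x (f i) = 0) ∧ ∀ j, 0 < MvPolynomial.eval x (g j)}

/-- A semialgebraic set: a finite union of basic semialgebraic sets. -/
def IsSemialgebraic {ι : Type} [Fintype ι] (S : Set (ι → ℝ)) : Prop :=
  ∃ (N : ℕ) (T : Fin N → Set (ι → ℝ)), (∀ i, IsBasicSemialgebraic (T i)) ∧ S = ⋃ i, T i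

/-- A linearity set of `ΘP`. -/
def IsLinearitySet (K : Set (Fin q → ℝ)) (A : Matrix (Fin m) (Fin q) ℝ)
    (M : Matrix (Fin r) (Fin q) ℝ) (b : Fin m → ℝ) (c d : Fin q → ℝ)
    (V : Set (Fin r → ℝ)) : Prop :=
  V ⊆ ThetaP K A M b d ∧ IsPathConnected V ∧
    (∀ v₁ ∈ V, ∀ v₂ ∈ V, Psi K A M b c d v₁ = Psi K A M b c d v₂) ∧
    (∀ v ∈ V, (Psi K A M b c d v).Nonempty) ∧
    (∃ v ∈ V, ∃ u ∈ Psi K A M b c d v, ∃ v' : Fin r → ℝ, v' ≠ v ∧ u ∈ Psi K A M b c d v') ∧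
    ∀ G : Set (Fin r → ℝ), G ⊆ ThetaP K A M b d → IsPathConnected G → V ⊂ G →
      ¬((∀ v₁ ∈ G, ∀ v₂ ∈ G, Psi K A M b c d v₁ = Psi K A M b c d v₂) ∧
        ∀ v ∈ G, (Psi K A M b c d v).Nonempty)

/-- A nonlinearity set of `ΘP`: a maximal path-connected open subset of `ΘP`
disjoint from every linearity set. -/
def IsNonlinearitySet (K : Set (Fin q → ℝ)) (A : Matrix (Fin m) (Fin q) ℝ)
    (M : Matrix (Fin r) (Fin q) ℝ) (b : Fin m → ℝ) (c d : Fin q → ℝ)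
    (V : Set (Fin r → ℝ)) : Prop :=
  V ⊆ ThetaP K A M b d ∧ IsPathConnected V ∧ IsOpen V ∧
    (∀ L, IsLinearitySet K A M b c d L → Disjoint V L) ∧
    ∀ G : Set (Fin r → ℝ), G ⊆ ThetaP K A M b d → IsPathConnected G → IsOpen G →
      (∀ L, IsLinearitySet K A M b c d L → Disjoint G L) → V ⊆ G → G = V

/-- The set of optimal solutions of the primal problem with objective `⟨c + Mᵀu, ·⟩`. -/
def Xstar (K : Set (Fin q → ℝ)) (A : Matrix (Fin m) (Fin q) ℝ)
    (M : Matrix (Fin r) (Fin q) ℝ) (b : Fin m → ℝ) (c : Fin q → ℝ)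
    (u : Fin r → ℝ) : Set (Fin q → ℝ) :=
  {x | x ∈ K ∧ A.mulVec x = b ∧
    ∀ x' ∈ K, A.mulVec x' = b → (c + Mᵀ.mulVec u) ⬝ᵥ x ≤ (c + Mᵀ.mulVec u) ⬝ᵥ x'}

/-- The set of optimal solutions `(w,y)` of the dual problem. -/
def Ystar (K : Set (Fin q → ℝ)) (A : Matrix (Fin m) (Fin q) ℝ)
    (M : Matrix (Fin r) (Fin q) ℝ) (b : Fin m → ℝ) (c : Fin q → ℝ)
    (u : Fin r → ℝ) : Set ((Fin m → ℝ) × (Fin q → ℝ)) :=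
  {p | Aᵀ.mulVec p.1 + p.2 = c + Mᵀ.mulVec u ∧ p.2 ∈ dualCone K ∧
    ∀ (w' : Fin m → ℝ) (y' : Fin q → ℝ),
      Aᵀ.mulVec w' + y' = c + Mᵀ.mulVec u → y' ∈ dualCone K → b ⬝ᵥ w' ≤ b ⬝ᵥ p.1}

/-- The optimal value function of the primal problem (1). -/
def valP (K : Set (Fin q → ℝ)) (A : Matrix (Fin m) (Fin q) ℝ)
    (M : Matrix (Fin r) (Fin q) ℝ) (b : Fin m → ℝ) (c d : Fin q → ℝ)
    (v : Fin r → ℝ) : ℝ :=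
  sInf {z | ∃ x ∈ K, A.mulVec x = b ∧ M.mulVec x = M.mulVec d + v ∧ z = c ⬝ᵥ x}

theorem aux_int (S : Set (Fin q → ℝ)) (x0 : Fin q → ℝ) (h : x0 ∈ interior S) :
    ∃ ε : ℝ, 0 < ε ∧ ∀ y : Fin q → ℝ, (∀ x ∈ S, 0 ≤ y ⬝ᵥ x) → ε * ‖y‖ ≤ y ⬝ᵥ x0 := by
  obtain ⟨δ, hδ, hb⟩ := Metric.isOpen_iff.1 isOpen_interior x0 h
  refine ⟨δ / 2, by positivity, fun y hy => ?_⟩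
  have h0 : 0 ≤ y ⬝ᵥ x0 := hy x0 (interior_subset h)
  have key : ∀ i, ∀ t : ℝ, |t| < δ → 0 ≤ y ⬝ᵥ x0 + y i * t := by
    intro i t ht
    have hmem : x0 + Pi.single i t ∈ S := by
      apply interior_subset
      apply hb
      rw [Metric.mem_ball, dist_eq_norm, add_sub_cancel_left, Pi.norm_single]
      simpa using ht
    have := hy _ hmem
    rwa [dotProduct_add, dotProduct_single] at this
  have h2 : ‖y‖ ≤ (y ⬝ᵥ x0) / (δ / 2) := by
    rw [pi_norm_le_iff_of_nonneg (by positivity)]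
    intro i
    rw [le_div_iff₀ (by positivity), Real.norm_eq_abs]
    have a1 := key i (δ / 2) (by rw [abs_of_pos (by positivity)]; linarith)
    have a2 := key i (-(δ / 2)) (by rw [abs_neg, abs_of_pos (by positivity)]; linarith)
    rcases abs_cases (y i) with ⟨h, _⟩ | ⟨h, _⟩ <;> rw [h] <;> nlinarith
  rw [le_div_iff₀ (by positivity)] at h2
  linarith

theorem aux_dual_closed (K : Set (Fin q → ℝ)) : IsClosed (dualCone K) := by
  have : dualCone K = ⋂ x ∈ K, {y | 0 ≤ y ⬝ᵥ x} := by
    ext y; simp [dualCone]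
  rw [this]
  refine isClosed_biInter fun x _ => isClosed_le continuous_const (by fun_prop)

theorem aux_phi (K : Set (Fin q → ℝ)) (hK : IsClosed K)
    (A : Matrix (Fin m) (Fin q) ℝ) (M : Matrix (Fin r) (Fin q) ℝ)
    (b : Fin m → ℝ) (c d : Fin q → ℝ) (hA2 : Assumption2 K A M b c) :
    IsClosed {p : (Fin r → ℝ) × (Fin r → ℝ) | p.2 ∈ Phi K A M b c d p.1} := by
  obtain ⟨⟨x0, hx0, hAx0⟩, w0, s, hy0⟩ := hA2
  set y0 := c - Aᵀ.mulVec w0 - Mᵀ.mulVec s with hy0def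
  obtain ⟨ε, hε, hε'⟩ := aux_int _ _ hx0
  obtain ⟨η, hη, hη'⟩ := aux_int _ _ hy0
  apply IsSeqClosed.isClosed
  intro p p0 hp hlim
  choose x w y h1 h2 h3 h4 h5 h6 using hp
  let g : (Fin r → ℝ) × (Fin r → ℝ) → ℝ :=
    fun p => x0 ⬝ᵥ y0 - (M.mulVec d + p.2 - M.mulVec x0) ⬝ᵥ (p.1 + s)
  have hg : Continuous g := by fun_prop
  obtain ⟨B, hB⟩ := ((hg.tendsto p0).comp hlim).bddAbove_range
  have hid : ∀ n, y n ⬝ᵥ x0 + x n ⬝ᵥ y0 = g (p n) := by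
    intro n
    have e1 : y n = c + Mᵀ.mulVec (p n).1 - Aᵀ.mulVec (w n) := by
      rw [← h4 n]; simp
    have tA : ∀ (z : Fin q → ℝ) (a : Fin m → ℝ), z ⬝ᵥ (Aᵀ.mulVec a) = A.mulVec z ⬝ᵥ a := by
      intro z a
      rw [dotProduct_mulVec, vecMul_transpose]
    have tM : ∀ (z : Fin q → ℝ) (a : Fin r → ℝ), z ⬝ᵥ (Mᵀ.mulVec a) = M.mulVec z ⬝ᵥ a := by
      intro z a
      rw [dotProduct_mulVec, vecMul_transpose]
    have h6' := h6 n
    rw [e1, dotProduct_sub, dotProduct_add, tM, tA, h1, h2] at h6'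
    rw [dotProduct_comm (y n) x0, e1]
    simp only [g]
    rw [hy0def]
    simp only [dotProduct_sub, dotProduct_add, sub_dotProduct, add_dotProduct, tM, tA, h1, h2,
      hAx0] at h6' ⊢
    linarith
  have hxn : ∀ n, 0 ≤ x n ⬝ᵥ y0 := fun n => by
    rw [dotProduct_comm]; exact interior_subset hy0 _ (h3 n)
  have hyn : ∀ n, 0 ≤ y n ⬝ᵥ x0 := fun n => h5 n _ (interior_subset hx0)
  have hgB : ∀ n, g (p n) ≤ B := fun n => hB ⟨n, rfl⟩
  have by' : ∀ n, ‖y n‖ ≤ B / ε := fun n => by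
    rw [le_div_iff₀ hε]
    have := hε' (y n) (h5 n)
    linarith [hid n, hgB n, hxn n]
  have bx' : ∀ n, ‖x n‖ ≤ B / η := fun n => by
    rw [le_div_iff₀ hη]
    have := hη' (x n) (fun z hz => by rw [dotProduct_comm]; exact hz _ (h3 n))
    linarith [hid n, hgB n, hyn n]
  obtain ⟨z, -, φ, hφ, hz⟩ := tendsto_subseq_of_bounded (x := fun n => (x n, y n))
    ((Metric.isBounded_closedBall (x := (0 : Fin q → ℝ)) (r := B / η)).prod
      (Metric.isBounded_closedBall (x := (0 : Fin q → ℝ)) (r := B / ε)))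
    (fun n => ⟨by simpa using bx' n, by simpa using by' n⟩)
  have hx : Tendsto (fun n => x (φ n)) atTop (𝓝 z.1) := (continuous_fst.tendsto z).comp hz
  have hy : Tendsto (fun n => y (φ n)) atTop (𝓝 z.2) := (continuous_snd.tendsto z).comp hz
  have hpl := hlim.comp hφ.tendsto_atTop
  have hu : Tendsto (fun n => (p (φ n)).1) atTop (𝓝 p0.1) := (continuous_fst.tendsto p0).comp hpl
  have hv : Tendsto (fun n => (p (φ n)).2) atTop (𝓝 p0.2) := (continuous_snd.tendsto p0).comp hpl
  have cA : Continuous fun z : Fin q → ℝ => A.mulVec z := by fun_prop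
  have cM : Continuous fun z : Fin q → ℝ => M.mulVec z := by fun_prop
  have cMt : Continuous fun z : Fin r → ℝ => Mᵀ.mulVec z := by fun_prop
  have hr : c + Mᵀ.mulVec p0.1 - z.2 ∈ LinearMap.range (Aᵀ.mulVecLin) := by
    have hc : IsClosed (LinearMap.range (Aᵀ.mulVecLin) : Set (Fin q → ℝ)) :=
      Submodule.closed_of_finiteDimensional _
    refine hc.mem_of_tendsto
      (((tendsto_const_nhds (x := c)).add ((cMt.tendsto _).comp hu)).sub hy)
      (Eventually.of_forall fun n => ⟨w (φ n), ?_⟩)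
    rw [mulVecLin_apply]
    exact eq_sub_of_add_eq (h4 (φ n))
  obtain ⟨w', hw'⟩ := hr
  refine ⟨z.1, w', z.2, ?_, ?_, ?_, ?_, ?_, ?_⟩
  · exact tendsto_nhds_unique ((cA.tendsto _).comp hx)
      (tendsto_const_nhds.congr fun n => (h1 (φ n)).symm)
  · exact tendsto_nhds_unique ((cM.tendsto _).comp hx)
      (((tendsto_const_nhds (x := M.mulVec d)).add hv).congr fun n => (h2 (φ n)).symm)
  · exact hK.mem_of_tendsto hx (Eventually.of_forall fun n => h3 (φ n))
  · rw [mulVecLin_apply] at hw'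
    rw [hw']; simp
  · exact (aux_dual_closed K).mem_of_tendsto hy (Eventually.of_forall fun n => h5 (φ n))
  · have cd : Continuous fun z : (Fin q → ℝ) × (Fin q → ℝ) => z.1 ⬝ᵥ z.2 := by fun_prop
    exact tendsto_nhds_unique ((cd.tendsto _).comp hz)
      (tendsto_const_nhds.congr fun n => (h6 (φ n)).symm)

/-- `Φ` and `Ψ` are outer semicontinuous, i.e. have closed graphs. -/
theorem stmt_8 (hq : 0 < q) (hm : 0 < m) (hr : 0 < r) (hmr : m + r ≤ q)
    (K : Set (Fin q → ℝ)) (hK : ConeAssumptions K)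
    (A : Matrix (Fin m) (Fin q) ℝ) (M : Matrix (Fin r) (Fin q) ℝ)
    (b : Fin m → ℝ) (c d : Fin q → ℝ)
    (hA1 : Assumption1 A M) (hA2 : Assumption2 K A M b c) :
    IsClosed {p : (Fin r → ℝ) × (Fin r → ℝ) | p.2 ∈ Phi K A M b c d p.1} ∧
    IsClosed {p : (Fin r → ℝ) × (Fin r → ℝ) | p.2 ∈ Psi K A M b c d p.1} := by
  have h := aux_phi K hK.1 A M b c d hA2
  exact ⟨h, h.preimage continuous_swap⟩
end
end

section
/- Under Assumptions 1 and 2, let ū ∈ int(ΘD) be such that Φ(ū) is a singleton {v̄}. Then Φ is continuous at ū relative to int(ΘD): for every ε > 0 there exists δ > 0 such that for every u ∈ int(ΘD) with ‖u − ū‖ < δ, the set Φ(u) is nonempty and Φ(u) ⊆ {v ∈ ℝ^r : ‖v − v̄‖ < ε}. -/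
open Matrix Set Topology Filter

noncomputable section

variable {q m r : ℕ}

theorem aux_zero_mem {K : Set (Fin q → ℝ)} (hK : ConeAssumptions K) : (0 : Fin q → ℝ) ∈ K := by
  obtain ⟨hc, -, hs, -, x, hx⟩ := hK
  have hxK := interior_subset hx
  have ht : Tendsto (fun t : ℝ => t • x) (𝓝[>] 0) (𝓝 ((0 : ℝ) • x)) :=
    ((continuous_id.smul continuous_const).tendsto (0 : ℝ)).mono_left nhdsWithin_le_nhds
  rw [zero_smul] at ht
  refine hc.mem_of_tendsto ht ?_
  filter_upwards [self_mem_nhdsWithin] with t ht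
  exact hs x hxK t ht

theorem aux_dual_convex (K : Set (Fin q → ℝ)) : Convex ℝ (dualCone K) := by
  intro y hy z hz a b ha hb _ x hx
  rw [add_dotProduct, smul_dotProduct, smul_dotProduct, smul_eq_mul, smul_eq_mul]
  have := hy x hx
  have := hz x hx
  positivity

theorem aux_AT (A : Matrix (Fin m) (Fin q) ℝ) (w : Fin m → ℝ) (x : Fin q → ℝ) :
    Aᵀ.mulVec w ⬝ᵥ x = w ⬝ᵥ A.mulVec x := by
  rw [mulVec_transpose, dotProduct_mulVec]

theorem aux_surj {A : Matrix (Fin m) (Fin q) ℝ} (hA : LinearIndependent ℝ A) :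
    Function.Surjective A.mulVec := by
  have h1 : A.rank = m := by
    simpa using LinearIndependent.rank_matrix (M := A) hA
  have h2 : LinearMap.range A.mulVecLin = ⊤ := by
    apply Submodule.eq_top_of_finrank_eq
    rw [Module.finrank_fin_fun]
    exact h1
  intro y
  obtain ⟨x, hx⟩ := LinearMap.range_eq_top.1 h2 y
  exact ⟨x, hx⟩

/-- strong duality -/
theorem aux_duality {K : Set (Fin q → ℝ)} (hK : ConeAssumptions K)
    {A : Matrix (Fin m) (Fin q) ℝ} {b : Fin m → ℝ} (hA : LinearIndependent ℝ A)
    {x0 : Fin q → ℝ} (hx0 : x0 ∈ interior K) (hAx0 : A.mulVec x0 = b)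
    (g x : Fin q → ℝ) (hx : x ∈ K) (hAx : A.mulVec x = b)
    (hopt : ∀ x' ∈ K, A.mulVec x' = b → g ⬝ᵥ x ≤ g ⬝ᵥ x') :
    ∃ w : Fin m → ℝ, g - Aᵀ.mulVec w ∈ dualCone K ∧ x ⬝ᵥ (g - Aᵀ.mulVec w) = 0 := by
  have hsurj := aux_surj hA
  let T : ((Fin q → ℝ) × ℝ) →ₗ[ℝ] ((Fin m → ℝ) × ℝ) :=
    { toFun := fun z => (A.mulVec z.1, g ⬝ᵥ z.1 + z.2)
      map_add' := by
        intro a b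
        ext1
        · simp [mulVec_add]
        · simp [dotProduct_add]; ring
      map_smul' := by
        intro a b
        ext1
        · simp [mulVec_smul]
        · simp [dotProduct_smul]; ring }
  have hT : Function.Surjective T := by
    rintro ⟨a, s⟩
    obtain ⟨x, rfl⟩ := hsurj a
    refine ⟨(x, s - g ⬝ᵥ x), ?_⟩
    ext1
    · rfl
    · show g ⬝ᵥ x + (s - g ⬝ᵥ x) = s
      ring
  have hTo : IsOpenMap T := by
    have := (LinearMap.toContinuousLinearMap T).isOpenMap hT
    exact this
  have hC : IsOpen (T '' (interior K ×ˢ Ioi (0:ℝ))) := hTo _ (isOpen_interior.prod isOpen_Ioi)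
  have hCc : Convex ℝ (T '' (interior K ×ˢ Ioi (0:ℝ))) :=
    (hK.2.1.interior.prod (convex_Ioi 0)).linear_image T
  have hn : (b, g ⬝ᵥ x) ∉ T '' (interior K ×ˢ Ioi (0:ℝ)) := by
    rintro ⟨⟨z, t⟩, ⟨hz, ht⟩, h⟩
    have h1 : A.mulVec z = b := congrArg Prod.fst h
    have h2 : g ⬝ᵥ z + t = g ⬝ᵥ x := congrArg Prod.snd h
    have h3 := hopt z (interior_subset hz) h1
    have h4 : 0 < t := ht
    linarith
  obtain ⟨f, hf⟩ := geometric_hahn_banach_open_point hCc hC hn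
  let ω : Fin m → ℝ := fun i => f (Pi.single i 1, 0)
  have hfr : ∀ a s, f (a, s) = ω ⬝ᵥ a + f (0, 1) * s := by
    intro a s
    have e1 : (a, s) = (a, (0:ℝ)) + s • ((0 : Fin m → ℝ), (1:ℝ)) := by
      ext1 <;> simp
    have e2 : f (a, (0:ℝ)) = ω ⬝ᵥ a := by
      have := LinearMap.pi_apply_eq_sum_univ
        (f.toLinearMap.comp (LinearMap.inl ℝ (Fin m → ℝ) ℝ)) a
      have h' : f (a, (0:ℝ)) = ∑ i, a i • f ((fun j => if i = j then 1 else 0), (0:ℝ)) := this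
      rw [h', dotProduct]
      refine Finset.sum_congr rfl fun i _ => ?_
      have : (fun j => if i = j then (1:ℝ) else 0) = Pi.single i 1 := by
        ext j; simp [Pi.single_apply, eq_comm]
      rw [this, smul_eq_mul, mul_comm]
    rw [e1, map_add, map_smul, e2, smul_eq_mul, mul_comm]
  set l := f (0, 1) with hl
  have key : ∀ z ∈ interior K, ∀ t : ℝ, 0 < t →
      ω ⬝ᵥ A.mulVec z + l * (g ⬝ᵥ z + t) < ω ⬝ᵥ b + l * (g ⬝ᵥ x) := by
    intro z hz t ht
    have := hf _ ⟨(z, t), ⟨hz, ht⟩, rfl⟩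
    have h' : f (A.mulVec z, g ⬝ᵥ z + t) < f (b, g ⬝ᵥ x) := this
    rwa [hfr, hfr] at h'
  have hl0 : l < 0 := by
    have h1 := key x0 hx0 1 one_pos
    have h2 := hopt x0 (interior_subset hx0) hAx0
    rw [hAx0] at h1
    by_contra hcon
    push Not at hcon
    nlinarith
  let w : Fin m → ℝ := (-l⁻¹) • ω
  have hw : ∀ a, w ⬝ᵥ a = -l⁻¹ * (ω ⬝ᵥ a) := fun a => by
    simp only [w, smul_dotProduct, smul_eq_mul]
  have hy : ∀ z, (g - Aᵀ.mulVec w) ⬝ᵥ z = g ⬝ᵥ z - w ⬝ᵥ A.mulVec z := fun z => by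
    rw [sub_dotProduct, aux_AT]
  have key2 : ∀ z ∈ interior K, g ⬝ᵥ x - w ⬝ᵥ b ≤ (g - Aᵀ.mulVec w) ⬝ᵥ z := by
    intro z hz
    rw [hy]
    refine le_of_forall_pos_le_add fun t ht => ?_
    have h1 := key z hz t ht
    rw [hw, hw]
    have h2 : (-l⁻¹) * (ω ⬝ᵥ A.mulVec z + l * (g ⬝ᵥ z + t))
        ≤ (-l⁻¹) * (ω ⬝ᵥ b + l * (g ⬝ᵥ x)) :=
      mul_le_mul_of_nonneg_left h1.le (by simpa using (inv_lt_zero.2 hl0).le)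
    have h3 : l⁻¹ * l = 1 := inv_mul_cancel₀ hl0.ne
    have e1 : (-l⁻¹) * (ω ⬝ᵥ A.mulVec z + l * (g ⬝ᵥ z + t))
        = -l⁻¹ * (ω ⬝ᵥ A.mulVec z) - (l⁻¹ * l) * (g ⬝ᵥ z + t) := by ring
    have e2 : (-l⁻¹) * (ω ⬝ᵥ b + l * (g ⬝ᵥ x))
        = -l⁻¹ * (ω ⬝ᵥ b) - (l⁻¹ * l) * (g ⬝ᵥ x) := by ring
    rw [e1, e2, h3] at h2
    linarith
  have key3 : ∀ z ∈ K, g ⬝ᵥ x - w ⬝ᵥ b ≤ (g - Aᵀ.mulVec w) ⬝ᵥ z := by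
    intro z hz
    have hcl : z ∈ closure (interior K) := by
      rw [hK.2.1.closure_interior_eq_closure_of_nonempty_interior hK.2.2.2.2]
      exact subset_closure hz
    have hclosed : IsClosed {z | g ⬝ᵥ x - w ⬝ᵥ b ≤ (g - Aᵀ.mulVec w) ⬝ᵥ z} :=
      isClosed_le continuous_const (by fun_prop)
    exact closure_minimal key2 hclosed hcl
  have hdual : g - Aᵀ.mulVec w ∈ dualCone K := by
    intro z hz
    by_contra hcon
    push Not at hcon
    set a := (g - Aᵀ.mulVec w) ⬝ᵥ z with ha
    have h0 := key3 0 (aux_zero_mem hK)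
    rw [dotProduct_zero] at h0
    have ht : 0 < (g ⬝ᵥ x - w ⬝ᵥ b - 1) / a := div_pos_of_neg_of_neg (by linarith) hcon
    have h1 := key3 _ (hK.2.2.1 z hz _ ht)
    rw [dotProduct_smul, smul_eq_mul, ← ha, div_mul_cancel₀ _ hcon.ne] at h1
    linarith
  refine ⟨w, hdual, ?_⟩
  rw [dotProduct_comm]
  have h0 := key3 0 (aux_zero_mem hK)
  rw [dotProduct_zero] at h0
  have h1 := hdual x hx
  have h2 := hy x
  rw [hAx] at h2
  linarith

theorem aux_phi_s10 {K : Set (Fin q → ℝ)} (hK : ConeAssumptions K)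
    {A : Matrix (Fin m) (Fin q) ℝ} (M : Matrix (Fin r) (Fin q) ℝ)
    {b : Fin m → ℝ} (c d : Fin q → ℝ) (hA : LinearIndependent ℝ A)
    {x0 : Fin q → ℝ} (hx0 : x0 ∈ interior K) (hAx0 : A.mulVec x0 = b)
    (u v : Fin r → ℝ) :
    v ∈ Phi K A M b c d u ↔ ∃ x ∈ Xstar K A M b c u, v = M.mulVec x - M.mulVec d := by
  constructor
  · rintro ⟨x, w, y, h1, h2, h3, h4, h5, h6⟩
    refine ⟨x, ⟨h3, h1, fun x' hx' hA' => ?_⟩, by rw [h2]; simp⟩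
    rw [← h4, add_dotProduct, add_dotProduct, aux_AT, aux_AT, h1, hA', dotProduct_comm y x, h6]
    have := h5 x' hx'
    linarith
  · rintro ⟨x, ⟨h1, h2, h3⟩, rfl⟩
    obtain ⟨w, hw, hw'⟩ := aux_duality hK hA hx0 hAx0 _ x h1 h2 h3
    exact ⟨x, w, _, h2, by simp, h1, by simp, hw, hw'⟩

theorem aux_strict {K : Set (Fin q → ℝ)}
    {A : Matrix (Fin m) (Fin q) ℝ} {M : Matrix (Fin r) (Fin q) ℝ} {c : Fin q → ℝ}
    {w : Fin m → ℝ} {s : Fin r → ℝ}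
    (hs : c - Aᵀ.mulVec w - Mᵀ.mulVec s ∈ interior (dualCone K))
    {u : Fin r → ℝ} (hu : u ∈ interior (ThetaD K A M c)) :
    ∃ (w : Fin m → ℝ), ∃ y ∈ interior (dualCone K), Aᵀ.mulVec w + y = c + Mᵀ.mulVec u := by
  have ht : Tendsto (fun t : ℝ => u + t • (u + s)) (𝓝[>] 0) (𝓝 (u + (0 : ℝ) • (u + s))) := by
    have : Continuous (fun t : ℝ => u + t • (u + s)) := by fun_prop
    exact (this.tendsto 0).mono_left nhdsWithin_le_nhds
  rw [zero_smul, add_zero] at ht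
  have h1 := (ht.eventually (mem_interior_iff_mem_nhds.1 hu)).and self_mem_nhdsWithin
  obtain ⟨t, ⟨w', y', hy', he⟩, ht0⟩ := h1.exists
  have ht0 : 0 < t := ht0
  have hpos : 0 < 1 + t := by linarith
  refine ⟨(1 / (1 + t)) • w' + (t / (1 + t)) • w, _,
    (aux_dual_convex K).combo_self_interior_mem_interior hy' hs
      (a := 1 / (1 + t)) (b := t / (1 + t)) (by positivity) (by positivity) (by field_simp), ?_⟩
  have he' : y' = c + Mᵀ.mulVec (u + t • (u + s)) - Aᵀ.mulVec w' := by
    rw [← he]; simp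
  rw [he']
  simp only [mulVec_add, mulVec_smul]
  ext i
  simp only [Pi.add_apply, Pi.smul_apply, Pi.sub_apply, smul_eq_mul]
  field_simp
  ring

theorem aux_bound {K : Set (Fin q → ℝ)} {y : Fin q → ℝ} {ρ : ℝ} (hρ : 0 < ρ)
    (hy : Metric.ball y (2 * ρ) ⊆ dualCone K) {z : Fin q → ℝ} (hz : ‖z - y‖ < ρ)
    {x : Fin q → ℝ} (hx : x ∈ K) : ρ * ‖x‖ ≤ z ⬝ᵥ x := by
  have hzx : ∀ (i : Fin q) (σ : ℝ), |σ| ≤ ρ → 0 ≤ z ⬝ᵥ x + σ * x i := by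
    intro i σ hσ
    have hmem : z + Pi.single i σ ∈ dualCone K := by
      apply hy
      rw [mem_ball_iff_norm]
      have e : z + Pi.single i σ - y = (z - y) + Pi.single i σ := by abel
      have h2 : ‖(Pi.single i σ : Fin q → ℝ)‖ = |σ| := by
        rw [Pi.norm_single, Real.norm_eq_abs]
      rw [e]
      have := norm_add_le (z - y) (Pi.single i σ)
      linarith
    have := hmem x hx
    rwa [add_dotProduct, single_dotProduct] at this
  have hz0 : 0 ≤ z ⬝ᵥ x := by
    apply hy _ x hx
    rw [mem_ball_iff_norm]; linarith
  rw [← le_div_iff₀' hρ, pi_norm_le_iff_of_nonneg (by positivity)]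
  intro i
  rw [le_div_iff₀' hρ, Real.norm_eq_abs]
  have h1 := hzx i ρ (by rw [abs_of_pos hρ])
  have h2 := hzx i (-ρ) (by rw [abs_neg, abs_of_pos hρ])
  rcases abs_cases (x i) with ⟨h, _⟩ | ⟨h, _⟩ <;> rw [h] <;> linarith

theorem aux_unif {K : Set (Fin q → ℝ)}
    {A : Matrix (Fin m) (Fin q) ℝ} {M : Matrix (Fin r) (Fin q) ℝ} {b : Fin m → ℝ}
    {c : Fin q → ℝ} {x0 : Fin q → ℝ} (hAx0 : A.mulVec x0 = b)
    {u : Fin r → ℝ} {w : Fin m → ℝ} {y : Fin q → ℝ} (hy : y ∈ interior (dualCone K))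
    (he : Aᵀ.mulVec w + y = c + Mᵀ.mulVec u) :
    ∃ R : ℝ, ∀ᶠ u' in 𝓝 u, ∀ x ∈ K, A.mulVec x = b →
      (c + Mᵀ.mulVec u') ⬝ᵥ x ≤ (c + Mᵀ.mulVec u') ⬝ᵥ x0 → ‖x‖ ≤ R := by
  obtain ⟨ρ', hρ', hb'⟩ := Metric.mem_nhds_iff.1 (mem_interior_iff_mem_nhds.1 hy)
  obtain ⟨ρ, hρ, rfl⟩ : ∃ ρ, 0 < ρ ∧ 2 * ρ = ρ' := ⟨ρ' / 2, by linarith, by ring⟩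
  let z : (Fin r → ℝ) → (Fin q → ℝ) := fun u' => c + Mᵀ.mulVec u' - Aᵀ.mulVec w
  have hzc : Continuous z := by
    have : Continuous fun u' : Fin r → ℝ => Mᵀ.mulVec u' := by fun_prop
    fun_prop
  have hzu : z u = y := by simp only [z]; rw [← he]; simp
  refine ⟨(y ⬝ᵥ x0 + 1) / ρ, ?_⟩
  have h1 : ∀ᶠ u' in 𝓝 u, ‖z u' - y‖ < ρ := by
    have hc : Continuous fun u' => ‖z u' - y‖ := by fun_prop
    refine (hc.tendsto u).eventually_lt_const ?_
    rw [hzu]; simpa using hρ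
  have h2 : ∀ᶠ u' in 𝓝 u, z u' ⬝ᵥ x0 < y ⬝ᵥ x0 + 1 := by
    have hc : Continuous fun u' => z u' ⬝ᵥ x0 := by fun_prop
    refine (hc.tendsto u).eventually_lt_const ?_
    rw [hzu]; linarith
  filter_upwards [h1, h2] with u' h1 h2 x hx hAx hle
  have h3 := aux_bound hρ hb' h1 hx
  rw [le_div_iff₀' hρ]
  have h4 : z u' ⬝ᵥ x ≤ z u' ⬝ᵥ x0 := by
    simp only [z]
    rw [sub_dotProduct, sub_dotProduct, aux_AT, aux_AT, hAx, hAx0]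
    linarith
  linarith

theorem aux_exists {K : Set (Fin q → ℝ)} (hK : IsClosed K)
    {A : Matrix (Fin m) (Fin q) ℝ} {M : Matrix (Fin r) (Fin q) ℝ} {b : Fin m → ℝ}
    {c : Fin q → ℝ} {x0 : Fin q → ℝ} (hx0 : x0 ∈ K) (hAx0 : A.mulVec x0 = b)
    {u : Fin r → ℝ} {R : ℝ}
    (hR : ∀ x ∈ K, A.mulVec x = b →
      (c + Mᵀ.mulVec u) ⬝ᵥ x ≤ (c + Mᵀ.mulVec u) ⬝ᵥ x0 → ‖x‖ ≤ R) :
    (Xstar K A M b c u).Nonempty := by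
  set g := c + Mᵀ.mulVec u with hg
  let S : Set (Fin q → ℝ) := {x | x ∈ K ∧ A.mulVec x = b ∧ g ⬝ᵥ x ≤ g ⬝ᵥ x0}
  have hcl : IsClosed S :=
    hK.inter ((isClosed_eq
      (show Continuous fun x : Fin q → ℝ => A.mulVec x by fun_prop) continuous_const).inter
      (isClosed_le (show Continuous fun x : Fin q → ℝ => g ⬝ᵥ x by fun_prop) continuous_const))
  have hcomp : IsCompact S := by
    refine (isCompact_closedBall (0 : Fin q → ℝ) R).of_isClosed_subset hcl ?_
    rintro x ⟨h1, h2, h3⟩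
    simpa using hR x h1 h2 h3
  have hcont : Continuous fun x : Fin q → ℝ => g ⬝ᵥ x := by fun_prop
  obtain ⟨x, ⟨h1, h2, h3⟩, hmin⟩ :=
    hcomp.exists_isMinOn ⟨x0, hx0, hAx0, le_rfl⟩ hcont.continuousOn
  refine ⟨x, h1, h2, fun x' hx' hA' => ?_⟩
  rw [← hg]
  by_cases h : g ⬝ᵥ x' ≤ g ⬝ᵥ x0
  · exact hmin ⟨hx', hA', h⟩
  · linarith

/-- continuity of `Φ` at points where it is single-valued. -/
theorem stmt_10 (hq : 0 < q) (hm : 0 < m) (hr : 0 < r) (hmr : m + r ≤ q)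
    (K : Set (Fin q → ℝ)) (hK : ConeAssumptions K)
    (A : Matrix (Fin m) (Fin q) ℝ) (M : Matrix (Fin r) (Fin q) ℝ)
    (b : Fin m → ℝ) (c d : Fin q → ℝ)
    (hA1 : Assumption1 A M) (hA2 : Assumption2 K A M b c)
    (ubar : Fin r → ℝ) (hubar : ubar ∈ interior (ThetaD K A M c))
    (vbar : Fin r → ℝ) (hsingle : Phi K A M b c d ubar = {vbar}) :
    ∀ ε > (0 : ℝ), ∃ δ > (0 : ℝ), ∀ u ∈ interior (ThetaD K A M c),
      ‖u - ubar‖ < δ →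
        (Phi K A M b c d u).Nonempty ∧
          Phi K A M b c d u ⊆ {v : Fin r → ℝ | ‖v - vbar‖ < ε} := by
  intro ε hε
  obtain ⟨⟨x0, hx0, hAx0⟩, w0, s0, hs0⟩ := hA2
  have hphi := aux_phi_s10 hK M c d hA1.1 hx0 hAx0
  obtain ⟨w, y, hy, he⟩ := aux_strict hs0 hubar
  obtain ⟨R, hR⟩ := aux_unif hAx0 hy he
  have hx0K := interior_subset hx0
  by_contra hcon
  push Not at hcon
  obtain ⟨δ0, hδ0, hball⟩ := Metric.eventually_nhds_iff_ball.1 hR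
  have hseq : ∀ n : ℕ, ∃ u x, ‖u - ubar‖ < 1 / ((n : ℝ) + 1) ∧ x ∈ Xstar K A M b c u ∧
      ‖x‖ ≤ R ∧ ε ≤ ‖M.mulVec x - M.mulVec d - vbar‖ := by
    intro n
    have hn : (0 : ℝ) < 1 / ((n : ℝ) + 1) := by positivity
    obtain ⟨u, -, hu, h⟩ := hcon (min δ0 (1 / ((n : ℝ) + 1))) (lt_min hδ0 hn)
    have hRu := hball u (mem_ball_iff_norm.2 (hu.trans_le (min_le_left _ _)))
    obtain ⟨x1, hx1⟩ := aux_exists hK.1 hx0K hAx0 hRu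
    have hne : (Phi K A M b c d u).Nonempty := ⟨_, (hphi u _).2 ⟨x1, hx1, rfl⟩⟩
    obtain ⟨v, hv, hv'⟩ := Set.not_subset.1 (h hne)
    obtain ⟨x, hx, rfl⟩ := (hphi u v).1 hv
    exact ⟨u, x, hu.trans_le (min_le_right _ _), hx,
      hRu x hx.1 hx.2.1 (hx.2.2 x0 hx0K hAx0), not_lt.1 hv'⟩
  choose u x hu hx hxR hxε using hseq
  obtain ⟨xh, -, φ, hφ, hlim⟩ := (isCompact_closedBall (0 : Fin q → ℝ) R).tendsto_subseq
    (x := x) (fun n => by simpa using hxR n)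
  have hulim : Tendsto u atTop (𝓝 ubar) := by
    rw [tendsto_iff_norm_sub_tendsto_zero]
    exact squeeze_zero (fun _ => norm_nonneg _) (fun n => (hu n).le)
      tendsto_one_div_add_atTop_nhds_zero_nat
  have hulim' := hulim.comp hφ.tendsto_atTop
  have hAc : Continuous fun x : Fin q → ℝ => A.mulVec x := by fun_prop
  have hopt : xh ∈ Xstar K A M b c ubar := by
    refine ⟨hK.1.mem_of_tendsto hlim (Eventually.of_forall fun n => (hx _).1), ?_, ?_⟩
    · refine tendsto_nhds_unique ((hAc.tendsto xh).comp hlim) ?_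
      refine tendsto_const_nhds.congr fun n => ?_
      exact ((hx (φ n)).2.1).symm
    · intro x' hx' hA'
      have hc1 : Continuous fun p : (Fin r → ℝ) × (Fin q → ℝ) =>
          (c + Mᵀ.mulVec p.1) ⬝ᵥ p.2 := by fun_prop
      have t1 := (hc1.tendsto (ubar, xh)).comp (hulim'.prodMk_nhds hlim)
      have t2 := (hc1.tendsto (ubar, x')).comp
        (hulim'.prodMk_nhds (tendsto_const_nhds (x := x')))
      exact le_of_tendsto_of_tendsto' t1 t2 fun n => (hx (φ n)).2.2 x' hx' hA'
  have hmem : M.mulVec xh - M.mulVec d ∈ Phi K A M b c d ubar := (hphi _ _).2 ⟨xh, hopt, rfl⟩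
  rw [hsingle, mem_singleton_iff] at hmem
  have hc2 : Continuous fun x : Fin q → ℝ => ‖M.mulVec x - M.mulVec d - vbar‖ := by fun_prop
  have hge := ge_of_tendsto' ((hc2.tendsto xh).comp hlim) fun n => hxε (φ n)
  rw [hmem, sub_self, norm_zero] at hge
  linarith
end
end
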